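/- Let 1 ≤ i, j ≤ m, a ∈ ℤ, r ∈ S, 1 ≤ l ≤ n, and assume either a > 0, or a = 0 and i < j. If β(r,0,j) ∉ I_l then [Σ_{k=1}^{n} psi_i^k(a−r) psibar_j^k(r), A_l] = 0 in W_N(S). If β(r,0,j) ∈ I_l then [Σ_{k=1}^{n} psi_i^k(a−r) psibar_j^k(r), A_l] = A_l^{i,j,r}, where A_l^{i,j,r} is the determinant obtained from A_l by replacing its β(r,0,j)-th column by the column (phi^1_{α(r,a,i)−1/2−ε}, phi^2_{α(r,a,i)−1/2−ε}, …, phi^l_{α(r,a,i)−1/2−ε})^t; moreover, in this case [A_{l'}, A_l^{i,j,r}] = 0 for all l ≤ l' ≤ n, [Abar_{l''}, A_l^{i,j,r}] = 0 for all l < l'' ≤ n, and A_l^{i,j,r}|0⟩ = 0 in F_N(S). -/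

import Mathlib

noncomputable section

/-- Context for the enlarged Weyl algebra `W_N(S)` with `N = m·n` and
`S = ℤ` (encoded by `sig = 0`) or `S = ℤ + 1/2` (encoded by `sig = 1`).
An element `r ∈ S` is encoded by the unique integer `k` with `r = k + sig/2`,
so that `ε := 1/2 - sig/2` and e.g. `r > 0 ↔ 0 < 2k + sig`.
The data also fixes a generic `q ∈ ℂˣ` together with a square root `sq` of `q`. -/
structure WCtx where
  m : ℕ
  n : ℕ
  hm : 0 < m
  hn : 0 < n
  sig : ℤ
  hsig : sig = 0 ∨ sig = 1
  q : ℂ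
  sq : ℂ
  hsq : sq ^ 2 = q
  hq0 : q ≠ 0
  hqu : ∀ k : ℕ, k ≠ 0 → q ^ k ≠ 1

namespace WCtx

variable (C : WCtx)

/-- `N = m n`. -/
def NN : ℕ := C.m * C.n

/-- Names of the generators of `W_N(S)`: `Sum.inl i` is `ψ_{i+1}` and
`Sum.inr i` is `ψ̄_{i+1}`; the integer `k` encodes the index `r = k + sig/2 ∈ S`. -/
abbrev Gen : Type := (Fin C.NN ⊕ Fin C.NN) × ℤ

/-- The defining relations of the enlarged Weyl algebra `W_N(S)`:
any two `ψ`'s commute, any two `ψ̄`'s commute, and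
`ψ̄_i(k)ψ_j(r) − ψ_j(r)ψ̄_i(k) = δ_{i,j} δ_{k+r,0}`. -/
inductive rel : FreeAlgebra ℂ C.Gen → FreeAlgebra ℂ C.Gen → Prop
  | comm_psi (i j : Fin C.NN) (k l : ℤ) :
      rel (FreeAlgebra.ι ℂ ((Sum.inl i, k) : C.Gen) * FreeAlgebra.ι ℂ ((Sum.inl j, l) : C.Gen))
          (FreeAlgebra.ι ℂ ((Sum.inl j, l) : C.Gen) * FreeAlgebra.ι ℂ ((Sum.inl i, k) : C.Gen))
  | comm_psibar (i j : Fin C.NN) (k l : ℤ) :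
      rel (FreeAlgebra.ι ℂ ((Sum.inr i, k) : C.Gen) * FreeAlgebra.ι ℂ ((Sum.inr j, l) : C.Gen))
          (FreeAlgebra.ι ℂ ((Sum.inr j, l) : C.Gen) * FreeAlgebra.ι ℂ ((Sum.inr i, k) : C.Gen))
  | mixed (i j : Fin C.NN) (k l : ℤ) :
      rel (FreeAlgebra.ι ℂ ((Sum.inr i, k) : C.Gen) * FreeAlgebra.ι ℂ ((Sum.inl j, l) : C.Gen))
          (FreeAlgebra.ι ℂ ((Sum.inl j, l) : C.Gen) * FreeAlgebra.ι ℂ ((Sum.inr i, k) : C.Gen)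
            + (if i = j ∧ k + l + C.sig = 0 then 1 else 0))

/-- The enlarged Weyl algebra `W_N(S)`. -/
def W : Type := RingQuot C.rel

instance : Ring C.W := inferInstanceAs (Ring (RingQuot C.rel))
instance : Algebra ℂ C.W := inferInstanceAs (Algebra ℂ (RingQuot C.rel))

/-- `ψ` with `0`-indexed flat subscript. -/
def psi0 (i : Fin C.NN) (k : ℤ) : C.W :=
  RingQuot.mkAlgHom ℂ C.rel (FreeAlgebra.ι ℂ ((Sum.inl i, k) : C.Gen))

/-- `ψ̄` with `0`-indexed flat subscript. -/
def psibar0 (i : Fin C.NN) (k : ℤ) : C.W :=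
  RingQuot.mkAlgHom ℂ C.rel (FreeAlgebra.ι ℂ ((Sum.inr i, k) : C.Gen))

/-- `ψ_i(r)` with `1`-indexed flat subscript `i ∈ {1,…,N}` (junk value `0` outside). -/
def psiF (i : ℕ) (k : ℤ) : C.W :=
  if h : 1 ≤ i ∧ i ≤ C.NN then C.psi0 ⟨i - 1, by omega⟩ k else 0

/-- `ψ̄_i(r)` with `1`-indexed flat subscript `i ∈ {1,…,N}` (junk value `0` outside). -/
def psibarF (i : ℕ) (k : ℤ) : C.W :=
  if h : 1 ≤ i ∧ i ≤ C.NN then C.psibar0 ⟨i - 1, by omega⟩ k else 0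

/-- `ψ_i^c(r) = ψ_{i+(c-1)m}(r)`, subscript `i ∈ {1,…,m}`, superscript `c ∈ {1,…,n}`. -/
def psiS (i c : ℕ) (k : ℤ) : C.W := C.psiF (i + (c - 1) * C.m) k

/-- `ψ̄_i^c(r) = ψ̄_{i+(c-1)m}(r)`. -/
def psibarS (i c : ℕ) (k : ℤ) : C.W := C.psibarF (i + (c - 1) * C.m) k

/-- The left ideal of `W_N(S)` generated by all `ψ_i(r), ψ̄_i(r)` with `r > 0`,
together with all `ψ̄_i(0)` when `S = ℤ`. -/
def vacIdeal : Submodule C.W C.W :=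
  Submodule.span C.W
    {w : C.W |
      (∃ (i : Fin C.NN) (k : ℤ), 0 < 2 * k + C.sig ∧ (w = C.psi0 i k ∨ w = C.psibar0 i k)) ∨
        (C.sig = 0 ∧ ∃ i : Fin C.NN, w = C.psibar0 i 0)}

/-- The Fock module `F_N(S) = W_N(S)/I`. -/
def F : Type := C.W ⧸ C.vacIdeal

instance : AddCommGroup C.F := inferInstanceAs (AddCommGroup (C.W ⧸ C.vacIdeal))
instance : Module C.W C.F := inferInstanceAs (Module C.W (C.W ⧸ C.vacIdeal))
instance : Module ℂ C.F := inferInstanceAs (Module ℂ (C.W ⧸ C.vacIdeal))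

/-- The vacuum vector `|0⟩ ∈ F_N(S)`. -/
def vac : C.F := Submodule.Quotient.mk (1 : C.W)

/-- Normal ordering `:u(k) v(l):` where `l` encodes the `S`-index of the second factor. -/
def nord (u : C.W) (l : ℤ) (v : C.W) : C.W :=
  if 0 < 2 * l + C.sig then u * v
  else if 2 * l + C.sig = 0 then (2 : ℂ)⁻¹ • (u * v + v * u)
  else v * u

/-- `ε = 0` if `S = ℤ + 1/2`, `ε = 1/2` if `S = ℤ`, as a complex number. -/
def eps : ℂ := (1 - (C.sig : ℂ)) / 2

/-- `ω_S(b)`. -/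
def om (b : ℤ) : ℂ :=
  if b = 0 then 0
  else if C.sig = 0 then (2 : ℂ)⁻¹ * ((C.q ^ b + 1) / (C.q ^ b - 1))
  else C.sq ^ b / (C.q ^ b - 1)

/-- `q^{-b r}` for `r = k + sig/2 ∈ S`. -/
def qp (b k : ℤ) : ℂ := C.sq ^ (-(b * (2 * k + C.sig)))

/-- `q^{b r}` for `r = k + sig/2 ∈ S`. -/
def qpp (b k : ℤ) : ℂ := C.sq ^ (b * (2 * k + C.sig))

/-- `φ^c_{t + sig/2}`; here `t ∈ ℤ` encodes the half-integer index `t + sig/2 = t + 1/2 - ε`.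
Writing `t = (k + sig)m - i` with `1 ≤ i ≤ m`, `k ∈ ℤ`, this is `ψ_i^c(k + sig/2)`. -/
def PhiW (c : ℕ) (t : ℤ) : C.W :=
  C.psiF ((((-t - 1).emod C.m).toNat + 1) + (c - 1) * C.m)
    ((t + (-t - 1).emod C.m + 1) / C.m - C.sig)

/-- `φ̄^c_{t + sig/2}`; writing `t = k·m + i - 1` with `1 ≤ i ≤ m`, `k ∈ ℤ`,
this is `ψ̄_i^c(k + sig/2)`. -/
def PhibarW (c : ℕ) (t : ℤ) : C.W :=
  C.psibarF (((t.emod C.m).toNat + 1) + (c - 1) * C.m) ((t - t.emod C.m) / C.m)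

/-- Determinant of a square matrix with (pairwise commuting) entries in `W_N(S)`. -/
def ncdet {l : ℕ} (M : Fin l → Fin l → C.W) : C.W :=
  ∑ p : Equiv.Perm (Fin l),
    (((Equiv.Perm.sign p : ℤˣ) : ℤ)) • ((List.finRange l).map fun t => M (p t) t).prod

/-- The element `A_l ∈ W_N(S)`, `1 ≤ l ≤ n`. -/
def Adet (l : ℕ) : C.W :=
  C.ncdet fun k t : Fin l => C.PhiW ((k : ℕ) + 1) (-(((t : ℕ) : ℤ) + 1))

/-- The element `Ā_l ∈ W_N(S)`, `1 ≤ l ≤ n`. -/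
def Abar (l : ℕ) : C.W :=
  C.ncdet fun s t : Fin (C.n - l + 1) => C.PhibarW (C.n - (s : ℕ)) (-(((t : ℕ) : ℤ) + 1))

/-- `α(r,a,i) = (a - r + 1/2 - ε)m - i + 1 = (a-k)m - i + 1` for `r = k + sig/2`. -/
def alphaV (k a : ℤ) (i : ℕ) : ℤ := (a - k) * C.m - (i : ℤ) + 1

/-- `β(r,a,j) = (r + a - 1/2 + ε)m + j = (k+a)m + j` for `r = k + sig/2`. -/
def betaV (k a : ℤ) (j : ℕ) : ℤ := (k + a) * C.m + (j : ℤ)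

/-- `Σ_{c=1}^{n} ψ_i^c(a-r) ψ̄_j^c(r)`, where `k` encodes `r`. -/
def Esum (i j : ℕ) (a k : ℤ) : C.W :=
  ∑ c : Fin C.n, C.psiS i ((c : ℕ) + 1) (a - k - C.sig) * C.psibarS j ((c : ℕ) + 1) k

/-- `A_l^{i,j,r}`: `A_l` with the `β(r,0,j)`-th column replaced by
`(φ^1_{α(r,a,i)-1/2-ε}, …, φ^l_{α(r,a,i)-1/2-ε})ᵗ`. -/
def Amod (l : ℕ) (i j : ℕ) (a k : ℤ) : C.W :=
  C.ncdet fun r t : Fin l =>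
    if (((t : ℕ) : ℤ) + 1) = C.betaV k 0 j then C.PhiW ((r : ℕ) + 1) (C.alphaV k a i - 1)
    else C.PhiW ((r : ℕ) + 1) (-(((t : ℕ) : ℤ) + 1))

/-- `Ā_l^{i,j,r}`: `Ā_l` with the `α(r,a,i)`-th column replaced by
`(-φ̄^n_{β(r,0,j)-1/2-ε}, …, -φ̄^l_{β(r,0,j)-1/2-ε})ᵗ`. -/
def Abarmod (l : ℕ) (i j : ℕ) (a k : ℤ) : C.W :=
  C.ncdet fun s t : Fin (C.n - l + 1) =>
    if (((t : ℕ) : ℤ) + 1) = C.alphaV k a i then -C.PhibarW (C.n - (s : ℕ)) (C.betaV k 0 j - 1)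
    else C.PhibarW (C.n - (s : ℕ)) (-(((t : ℕ) : ℤ) + 1))

/-- `l̄₁` for `l = l₁ m + l₂`, `1 ≤ l₂ ≤ m`. -/
def lb1 (l : ℕ) : ℕ :=
  if (l - 1) / C.m % 2 = 0 then ((l - 1) / C.m / 2) * C.m + ((l - 1) % C.m + 1)
  else (((l - 1) / C.m + 1) / 2) * C.m

/-- `l̄₂ = l - l̄₁`. -/
def lb2 (l : ℕ) : ℕ := l - C.lb1 l

/-- The `(k,t)` entry of the matrix defining `B_l`. -/
def Bentry (l : ℕ) (k t : Fin l) : C.W :=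
  if (t : ℕ) + 1 ≤ C.lb1 l then C.PhiW ((k : ℕ) + 1) (-(((t : ℕ) : ℤ) + 1))
  else C.PhibarW (C.n - (k : ℕ)) (-((((t : ℕ) : ℤ) + 1) - (C.lb1 l : ℤ)))

/-- The element `B_l ∈ W_N(S)`, `1 ≤ l ≤ n`. -/
def Bdet (l : ℕ) : C.W := C.ncdet (C.Bentry l)

/-- The element `B̄_{n/2} ∈ W_N(S)` (`n` even): `B_{n/2}` with its `(n/2)`-th row replaced. -/
def Bbar : C.W :=
  C.ncdet fun k t : Fin (C.n / 2) =>
    if (k : ℕ) + 1 = C.n / 2 then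
      (if (t : ℕ) + 1 ≤ C.lb1 (C.n / 2) then C.PhiW (C.n / 2 + 1) (-(((t : ℕ) : ℤ) + 1))
       else C.PhibarW (C.n / 2) (-((((t : ℕ) : ℤ) + 1) - (C.lb1 (C.n / 2) : ℤ))))
    else C.Bentry (C.n / 2) k t

/-- `B_l` with its `pos`-th column replaced by the column `(col 1, …, col l)ᵗ`. -/
def Bcolrep (l : ℕ) (pos : ℤ) (col : ℕ → C.W) : C.W :=
  C.ncdet fun k t : Fin l =>
    if (((t : ℕ) : ℤ) + 1) = pos then col ((k : ℕ) + 1) else C.Bentry l k t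

/-- The operator `T_{i,j}(a,b) = Σ_{r∈S} q^{-br} Σ_{c=1}^n :ψ_i^c(a-r) ψ̄_j^c(r):`. -/
def Top (i j : ℕ) (a b : ℤ) (x : C.F) : C.F :=
  ∑ᶠ k : ℤ, (C.qp b k • ∑ c : Fin C.n,
    C.nord (C.psiS i ((c : ℕ) + 1) (a - k - C.sig)) k (C.psibarS j ((c : ℕ) + 1) k)) • x

/-- The operator `S_{i,j}(c,d) = Σ_{e=1}^n ψ_i^e(c) ψ̄_j^e(d)`. -/
def Sop (i j : ℕ) (c d : ℤ) (x : C.F) : C.F :=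
  (∑ e : Fin C.n, C.psiS i ((e : ℕ) + 1) c * C.psibarS j ((e : ℕ) + 1) d) • x

/-- The operator `E_{p,p} = Σ_{c=1}^m Σ_{r∈S} :ψ_c^p(-r) ψ̄_c^p(r): − ε m`. -/
def Epp (p : ℕ) (x : C.F) : C.F :=
  (∑ᶠ k : ℤ, (∑ c : Fin C.m,
      C.nord (C.psiS ((c : ℕ) + 1) p (-k - C.sig)) k (C.psibarS ((c : ℕ) + 1) p k)) • x)
    - (C.eps * (C.m : ℂ)) • x

/-- The operator `E_i(b) = Σ_{r∈S} q^{-br} Σ_{c=1}^n :ψ_i^c(-r) ψ̄_i^c(r): − n ω_S(b)`. -/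
def Eib (i : ℕ) (b : ℤ) (x : C.F) : C.F :=
  (∑ᶠ k : ℤ, (C.qp b k • ∑ c : Fin C.n,
      C.nord (C.psiS i ((c : ℕ) + 1) (-k - C.sig)) k (C.psibarS i ((c : ℕ) + 1) k)) • x)
    - ((C.n : ℂ) * C.om b) • x

/-- `Σ_{r ∈ J^S_{i,l}} q^{-br}`. -/
def Jsum (i l : ℕ) (b : ℤ) : ℂ :=
  ∑ᶠ k ∈ {k : ℤ | 1 ≤ k * (C.m : ℤ) + (i : ℤ) ∧ k * (C.m : ℤ) + (i : ℤ) ≤ (l : ℤ)}, C.qp b k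

/-- `Σ_{r ∈ J̄^S_{i,l}} q^{-br}`. -/
def Jbarsum (i l : ℕ) (b : ℤ) : ℂ :=
  ∑ᶠ k ∈ {k : ℤ | 1 ≤ -(k * (C.m : ℤ)) - (i : ℤ) + 1 ∧ -(k * (C.m : ℤ)) - (i : ℤ) + 1 ≤ (l : ℤ)},
    C.qp b k

/-- `Σ_{r ∈ J^S_{i,l}} q^{br}`. -/
def JsumP (i l : ℕ) (b : ℤ) : ℂ :=
  ∑ᶠ k ∈ {k : ℤ | 1 ≤ k * (C.m : ℤ) + (i : ℤ) ∧ k * (C.m : ℤ) + (i : ℤ) ≤ (l : ℤ)}, C.qpp b k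

/-- `Σ_{c=1}^m ψ_c^p(-r) ψ̄_c^{p+1}(r)` (no normal ordering), `k` encoding `r ∈ S`. -/
def glRaise (p : ℕ) (k : ℤ) : C.W :=
  ∑ c : Fin C.m, C.psiS ((c : ℕ) + 1) p (-k - C.sig) * C.psibarS ((c : ℕ) + 1) (p + 1) k

/-- The operator `Σ_{c=1}^m Σ_{r∈S} :ψ_c^p(-r) ψ̄_c^{p+1}(r):`. -/
def glRaiseOp (p : ℕ) (x : C.F) : C.F :=
  ∑ᶠ k : ℤ, (∑ c : Fin C.m,
    C.nord (C.psiS ((c : ℕ) + 1) p (-k - C.sig)) k (C.psibarS ((c : ℕ) + 1) (p + 1) k)) • x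

end WCtx

theorem List.mul_prod_map_sub_prod_map_mul {R ι : Type*} [Ring R] [DecidableEq ι] (E g : R)
    (f : ι → R) (t₀ : ι) (hf : ∀ t, E * f t - f t * E = if t = t₀ then g else 0) (L : List ι)
    (hL : L.Nodup) :
    E * (L.map f).prod - (L.map f).prod * E
      = if t₀ ∈ L then (L.map fun t => if t = t₀ then g else f t).prod else 0 := by
  induction L with
  | nil => simp
  | cons x L ih =>
    obtain ⟨hx, hL⟩ := List.nodup_cons.1 hL
    have ih := ih hL
    have hx' := hf x
    simp only [List.map_cons, List.prod_cons]
    have expand : E * (f x * (L.map f).prod) - f x * (L.map f).prod * E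
        = (E * f x - f x * E) * (L.map f).prod
          + f x * (E * (L.map f).prod - (L.map f).prod * E) := by noncomm_ring
    rw [expand, ih, hx']
    by_cases h : x = t₀
    · subst h
      have : (L.map fun t => if t = x then g else f t) = L.map f :=
        List.map_congr_left fun t ht => if_neg (by rintro rfl; exact hx ht)
      simp [hx, this]
    · simp [h, Ne.symm h]

theorem Submodule.list_prod_mem_of_commute {R : Type*} [Ring R] (I : Submodule R R) (L : List R)
    (hL : ∀ x ∈ L, ∀ y ∈ L, Commute x y) {x : R} (hxL : x ∈ L) (hx : x ∈ I) : L.prod ∈ I := by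
  induction L with
  | nil => simp at hxL
  | cons y L ih =>
    rw [List.prod_cons]
    rcases List.mem_cons.1 hxL with rfl | h
    · rw [(Commute.list_prod_right _ _ fun z hz =>
        hL _ List.mem_cons_self z (List.mem_cons_of_mem _ hz) : Commute x L.prod).eq]
      exact I.smul_mem _ hx
    · exact I.smul_mem _ (ih (fun u hu v hv =>
        hL u (List.mem_cons_of_mem _ hu) v (List.mem_cons_of_mem _ hv)) h)

namespace WCtx

theorem psiF_commute (C : WCtx) (i j : ℕ) (k l : ℤ) :
    Commute (C.psiF i k) (C.psiF j l) := by
  unfold psiF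
  split_ifs
  · have h := RingQuot.mkAlgHom_rel ℂ (rel.comm_psi (C := C) ⟨i - 1, by omega⟩ ⟨j - 1, by omega⟩ k l)
    rwa [map_mul, map_mul] at h
  all_goals simp

theorem psibar0_mul_psi0 (C : WCtx) (i j : Fin C.NN) (k l : ℤ) :
    C.psibar0 i k * C.psi0 j l
      = C.psi0 j l * C.psibar0 i k + if i = j ∧ k + l + C.sig = 0 then 1 else 0 := by
  have h := RingQuot.mkAlgHom_rel ℂ (rel.mixed (C := C) i j k l)
  rw [map_mul, map_add, map_mul, apply_ite (RingQuot.mkAlgHom ℂ C.rel), map_one, map_zero] at h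
  exact h

theorem psibarF_commute_psiF (C : WCtx) {i j : ℕ} (hij : i ≠ j) (k l : ℤ) :
    Commute (C.psibarF i k) (C.psiF j l) := by
  unfold psibarF psiF
  split_ifs
  · have h := C.psibar0_mul_psi0 ⟨i - 1, by omega⟩ ⟨j - 1, by omega⟩ k l
    rwa [if_neg (by rw [Fin.mk.injEq]; omega), add_zero] at h
  all_goals simp

theorem psibarF_mul_psiF (C : WCtx) {i : ℕ} (hi : 1 ≤ i) (hi' : i ≤ C.NN) (k l : ℤ) :
    C.psibarF i k * C.psiF i l
      = C.psiF i l * C.psibarF i k + if k + l + C.sig = 0 then 1 else 0 := by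
  unfold psibarF psiF
  rw [dif_pos ⟨hi, hi'⟩, dif_pos ⟨hi, hi'⟩, C.psibar0_mul_psi0]
  simp

theorem eq_of_add_mul_eq {m i j a b : ℕ} (hi : 1 ≤ i) (hi' : i ≤ m) (hj : 1 ≤ j)
    (hj' : j ≤ m) (h : i + a * m = j + b * m) : i = j ∧ a = b := by
  rcases lt_trichotomy a b with hab | hab | hab
  · nlinarith [Nat.mul_le_mul_right m hab]
  · subst hab; omega
  · nlinarith [Nat.mul_le_mul_right m hab]

theorem int_eq_of_add_mul_eq {m i j a b : ℤ} (hi : 1 ≤ i) (hi' : i ≤ m) (hj : 1 ≤ j)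
    (hj' : j ≤ m) (h : a * m + i = b * m + j) : i = j ∧ a = b := by
  rcases lt_trichotomy a b with hab | hab | hab
  · nlinarith
  · subst hab; omega
  · nlinarith

theorem PhiW_eq_psiS (C : WCtx) {i : ℕ} (hi : 1 ≤ i) (hi' : i ≤ C.m) (c : ℕ) (k : ℤ) :
    C.PhiW c ((k + C.sig) * C.m - i) = C.psiS i c k := by
  have hm : (0 : ℤ) < C.m := by exact_mod_cast C.hm
  have h1 : (-((k + C.sig) * C.m - i) - 1).emod C.m = (i : ℤ) - 1 := by
    change (-((k + C.sig) * C.m - i) - 1) % (C.m : ℤ) = _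
    rw [show -((k + C.sig) * C.m - i) - 1 = ((i : ℤ) - 1) + C.m * (-(k + C.sig)) by ring,
      Int.add_mul_emod_self_left]
    exact Int.emod_eq_of_lt (by omega) (by omega)
  unfold PhiW psiS
  rw [h1, show (k + C.sig) * C.m - (i : ℤ) + (i - 1) + 1 = (k + C.sig) * C.m by ring,
    Int.mul_ediv_cancel _ hm.ne', show ((i : ℤ) - 1).toNat + 1 = i by omega]
  congr 1
  ring

theorem exists_PhiW_eq_psiS (C : WCtx) (t : ℤ) :
    ∃ (i : ℕ) (k : ℤ), 1 ≤ i ∧ i ≤ C.m ∧ t = (k + C.sig) * C.m - i ∧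
      ∀ c, C.PhiW c t = C.psiS i c k := by
  have hm : (0 : ℤ) < C.m := by exact_mod_cast C.hm
  have h0 := Int.emod_nonneg (-t - 1) hm.ne'
  have h1 := Int.emod_lt_of_pos (-t - 1) hm
  have h2 := Int.emod_add_mul_ediv (-t - 1) C.m
  have ht : t = ((-((-t - 1) / C.m) - C.sig) + C.sig) * C.m
      - (((-t - 1) % C.m).toNat + 1 : ℕ) := by
    push_cast [Int.toNat_of_nonneg h0]
    linear_combination h2
  refine ⟨((-t - 1) % C.m).toNat + 1, -((-t - 1) / C.m) - C.sig, by omega, by omega, ht, ?_⟩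
  intro c
  conv_lhs => rw [ht]
  exact C.PhiW_eq_psiS (by omega) (by omega) c _

theorem PhiW_commute (C : WCtx) (c d : ℕ) (s t : ℤ) :
    Commute (C.PhiW c s) (C.PhiW d t) :=
  C.psiF_commute _ _ _ _

theorem PhibarW_commute_PhiW (C : WCtx) {c d : ℕ} (hc : 1 ≤ c) (hd : 1 ≤ d) (hcd : c ≠ d)
    (s t : ℤ) : Commute (C.PhibarW c s) (C.PhiW d t) := by
  have hm : (0 : ℤ) < C.m := by exact_mod_cast C.hm
  have h1 := Int.emod_lt_of_pos s hm
  have h2 := Int.emod_lt_of_pos (-t - 1) hm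
  have h3 := Int.emod_nonneg s hm.ne'
  have h4 := Int.emod_nonneg (-t - 1) hm.ne'
  refine C.psibarF_commute_psiF (fun h => ?_) _ _
  have := (eq_of_add_mul_eq (m := C.m) (i := (s % C.m).toNat + 1)
    (j := ((-t - 1) % C.m).toNat + 1) (by omega) (by omega) (by omega) (by omega) h).2
  omega

theorem psibarS_mul_PhiW (C : WCtx) {j c d : ℕ} (hj : 1 ≤ j) (hj' : j ≤ C.m) (hc : 1 ≤ c)
    (hc' : c ≤ C.n) (hd : 1 ≤ d) (k t : ℤ) :
    C.psibarS j c k * C.PhiW d (-t)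
      = C.PhiW d (-t) * C.psibarS j c k + if c = d ∧ t = C.betaV k 0 j then 1 else 0 := by
  obtain ⟨i, k', hi, hi', ht, hphi⟩ := C.exists_PhiW_eq_psiS (-t)
  rw [hphi]
  unfold psibarS psiS
  have key : t = C.betaV k 0 j ↔ i = j ∧ k + k' + C.sig = 0 := by
    unfold betaV
    constructor
    · intro h
      have := int_eq_of_add_mul_eq (m := C.m) (i := i) (j := j) (a := -(k' + C.sig)) (b := k)
        (by omega) (by omega) (by omega) (by omega) (by linear_combination h + ht)
      omega
    · rintro ⟨rfl, h⟩
      linear_combination -ht - (C.m : ℤ) * h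
  by_cases hij : j + (c - 1) * C.m = i + (d - 1) * C.m
  · obtain ⟨rfl, hcd⟩ := eq_of_add_mul_eq hj hj' hi hi' hij
    obtain rfl : c = d := by omega
    have hN : j + (c - 1) * C.m ≤ C.NN := by
      unfold NN
      have := Nat.mul_le_mul_right C.m hc'
      have h2 : c * C.m = (c - 1) * C.m + C.m := by
        conv_lhs => rw [show c = c - 1 + 1 by omega, add_mul, one_mul]
      nlinarith
    rw [C.psibarF_mul_psiF (by omega) hN]
    simp [key]
  · rw [(C.psibarF_commute_psiF hij k k').eq, if_neg, add_zero]
    rintro ⟨rfl, h⟩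
    exact hij (by rw [(key.1 h).1])

theorem Esum_mul_PhiW_sub (C : WCtx) {i j d : ℕ} (hi : 1 ≤ i) (hi' : i ≤ C.m)
    (hj : 1 ≤ j) (hj' : j ≤ C.m) (hd : d < C.n) (a k t : ℤ) :
    C.Esum i j a k * C.PhiW (d + 1) (-t) - C.PhiW (d + 1) (-t) * C.Esum i j a k
      = if t = C.betaV k 0 j then C.PhiW (d + 1) (C.alphaV k a i - 1) else 0 := by
  have halpha : C.PhiW (d + 1) (C.alphaV k a i - 1) = C.psiS i (d + 1) (a - k - C.sig) := by
    rw [← C.PhiW_eq_psiS hi hi', alphaV]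
    congr 1
    ring
  have hterm : ∀ c : Fin C.n,
      C.psiS i (c + 1) (a - k - C.sig) * C.psibarS j (c + 1) k * C.PhiW (d + 1) (-t)
        - C.PhiW (d + 1) (-t) * (C.psiS i (c + 1) (a - k - C.sig) * C.psibarS j (c + 1) k)
      = if c = ⟨d, hd⟩ then
          (if t = C.betaV k 0 j then C.psiS i (c + 1) (a - k - C.sig) else 0) else 0 := by
    intro c
    have hcomm : Commute (C.psiS i (c + 1) (a - k - C.sig)) (C.PhiW (d + 1) (-t)) :=
      C.psiF_commute _ _ _ _
    rw [mul_assoc, C.psibarS_mul_PhiW hj hj' (by omega) (by omega) (by omega), mul_add,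
      ← mul_assoc, hcomm.eq, ← mul_assoc, add_sub_cancel_left]
    simp [Fin.ext_iff, ite_and]
  unfold Esum
  rw [Finset.sum_mul, Finset.mul_sum, ← Finset.sum_sub_distrib, Finset.sum_congr rfl
    (fun c _ => hterm c), Finset.sum_ite_eq' Finset.univ, halpha]
  simp

theorem ncdet_commute_right (C : WCtx) {l : ℕ} (M : Fin l → Fin l → C.W) (x : C.W)
    (h : ∀ r t, Commute x (M r t)) : Commute x (C.ncdet M) := by
  unfold ncdet
  refine Commute.sum_right _ _ _ fun p _ => Commute.smul_right (Commute.list_prod_right _ _ ?_) _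
  intro y hy
  obtain ⟨t, -, rfl⟩ := List.mem_map.1 hy
  exact h _ _

theorem ncdet_commute_ncdet (C : WCtx) {l l' : ℕ} (M : Fin l → Fin l → C.W)
    (M' : Fin l' → Fin l' → C.W) (h : ∀ r t r' t', Commute (M r t) (M' r' t')) :
    Commute (C.ncdet M) (C.ncdet M') :=
  C.ncdet_commute_right _ _ fun r t =>
    (C.ncdet_commute_right _ _ fun r' t' => (h r' t' r t).symm).symm

theorem ncdet_eq_zero_of_column_eq (C : WCtx) {l : ℕ} (M : Fin l → Fin l → C.W)
    (h : ∀ r t r' t', Commute (M r t) (M r' t')) {t₁ t₂ : Fin l} (hne : t₁ ≠ t₂)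
    (heq : ∀ r, M r t₁ = M r t₂) : C.ncdet M = 0 := by
  have hswap : ∀ r t, M r (Equiv.swap t₁ t₂ t) = M r t := by
    intro r t
    rw [Equiv.swap_apply_def]
    split_ifs with h1 h2
    · rw [h1, heq]
    · rw [h2, heq]
    · rfl
  unfold ncdet
  refine Finset.sum_involution (fun p _ => p * Equiv.swap t₁ t₂) ?_ ?_ ?_ ?_
  · intro p _
    have hprod : ((List.finRange l).map fun t => M ((p * Equiv.swap t₁ t₂) t) t).prod
        = ((List.finRange l).map fun t => M (p t) t).prod := by
      have hmap : ((List.finRange l).map fun t => M ((p * Equiv.swap t₁ t₂) t) t)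
          = ((List.finRange l).map (Equiv.swap t₁ t₂)).map fun t => M (p t) t := by
        rw [List.map_map]
        exact List.map_congr_left fun t _ => (hswap _ t).symm
      rw [hmap]
      refine List.Perm.prod_eq' ((Equiv.Perm.map_finRange_perm _).map _) ?_
      rw [List.pairwise_map]
      exact List.pairwise_of_forall fun _ _ => h _ _ _ _
    rw [hprod, Equiv.Perm.sign_mul, Equiv.Perm.sign_swap hne]
    simp
  · intro p _ _ hp
    exact hne (Equiv.swap_eq_one_iff.1 (mul_eq_left.1 hp))
  · simp
  · intro p _
    simp [mul_assoc]

theorem ncdet_mem_of_column_mem (C : WCtx) {l : ℕ} (M : Fin l → Fin l → C.W)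
    (h : ∀ r t r' t', Commute (M r t) (M r' t')) (I : Submodule C.W C.W) (t₀ : Fin l)
    (ht₀ : ∀ r, M r t₀ ∈ I) : C.ncdet M ∈ I := by
  unfold ncdet
  refine Submodule.sum_mem _ fun p _ => zsmul_mem ?_ _
  refine Submodule.list_prod_mem_of_commute I _ ?_
    (List.mem_map_of_mem (List.mem_finRange t₀)) (ht₀ (p t₀))
  intro x hx y hy
  obtain ⟨t, -, rfl⟩ := List.mem_map.1 hx
  obtain ⟨t', -, rfl⟩ := List.mem_map.1 hy
  exact h _ _ _ _

theorem mul_ncdet_sub (C : WCtx) {l : ℕ} (M : Fin l → Fin l → C.W) (E : C.W)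
    (g : Fin l → C.W) (t₀ : Fin l)
    (h : ∀ r t, E * M r t - M r t * E = if t = t₀ then g r else 0) :
    E * C.ncdet M - C.ncdet M * E = C.ncdet fun r t => if t = t₀ then g r else M r t := by
  unfold ncdet
  rw [Finset.mul_sum, Finset.sum_mul, ← Finset.sum_sub_distrib]
  refine Finset.sum_congr rfl fun p _ => ?_
  have key := List.mul_prod_map_sub_prod_map_mul E (g (p t₀)) (fun t => M (p t) t) t₀
    (fun t => by rw [h]; split_ifs with ht <;> simp [ht]) (List.finRange l) (List.nodup_finRange l)
  rw [mul_smul_comm, smul_mul_assoc, ← smul_sub, key, if_pos (List.mem_finRange t₀)]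
  congr 3
  funext t
  split_ifs with ht <;> simp [ht]

theorem psiS_mem_vacIdeal (C : WCtx) (i c : ℕ) {k : ℤ} (hk : 0 < 2 * k + C.sig) :
    C.psiS i c k ∈ C.vacIdeal := by
  unfold psiS psiF
  split_ifs
  · exact Submodule.subset_span (Or.inl ⟨_, k, hk, Or.inl rfl⟩)
  · exact Submodule.zero_mem _

theorem smul_vac_eq_zero (C : WCtx) {w : C.W} (hw : w ∈ C.vacIdeal) : w • C.vac = 0 := by
  change (Submodule.Quotient.mk (w • (1 : C.W)) : C.W ⧸ C.vacIdeal) = 0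
  rw [smul_eq_mul, mul_one]
  exact (Submodule.Quotient.mk_eq_zero _).2 hw

theorem Amod_entry_eq (C : WCtx) (i j r : ℕ) (a k : ℤ) (t : ℕ) :
    (if ((t : ℤ) + 1) = C.betaV k 0 j then C.PhiW (r + 1) (C.alphaV k a i - 1)
      else C.PhiW (r + 1) (-((t : ℤ) + 1)))
    = C.PhiW (r + 1) (if ((t : ℤ) + 1) = C.betaV k 0 j then C.alphaV k a i - 1
        else -((t : ℤ) + 1)) := by
  split_ifs <;> rfl

theorem Amod_eq_ncdet_PhiW (C : WCtx) (l i j : ℕ) (a k : ℤ) :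
    C.Amod l i j a k = C.ncdet fun r t : Fin l =>
      C.PhiW ((r : ℕ) + 1) (if (((t : ℕ) : ℤ) + 1) = C.betaV k 0 j then C.alphaV k a i - 1
        else -(((t : ℕ) : ℤ) + 1)) := by
  unfold Amod
  simp only [Amod_entry_eq]

theorem Amod_smul_vac (C : WCtx) {i j : ℕ} (hi : 1 ≤ i) (hi' : i ≤ C.m) (hj : 1 ≤ j)
    {a k : ℤ} {l : ℕ} (ha : 0 < a ∨ (a = 0 ∧ i < j))
    (hb : 1 ≤ C.betaV k 0 j) (hb' : C.betaV k 0 j ≤ l) :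
    C.Amod l i j a k • C.vac = 0 := by
  apply C.smul_vac_eq_zero
  rw [Amod_eq_ncdet_PhiW]
  have hm : (0 : ℤ) < C.m := by exact_mod_cast C.hm
  have ht₀ : (((C.betaV k 0 j).toNat - 1 : ℕ) : ℤ) + 1 = C.betaV k 0 j := by omega
  have halpha : C.alphaV k a i - 1 = ((a - k - C.sig) + C.sig) * C.m - i := by
    unfold alphaV; ring
  by_cases hak : 0 < a - k
  · refine C.ncdet_mem_of_column_mem _ (fun _ _ _ _ => C.PhiW_commute _ _ _ _) _
      ⟨(C.betaV k 0 j).toNat - 1, by omega⟩ fun r => ?_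
    rw [if_pos ht₀, halpha, C.PhiW_eq_psiS hi hi']
    exact C.psiS_mem_vacIdeal _ _ (by rcases C.hsig with h | h <;> omega)
  · have hpos : 1 ≤ 1 - C.alphaV k a i := by
      unfold alphaV
      nlinarith
    have hlt : 1 - C.alphaV k a i < C.betaV k 0 j := by
      unfold alphaV betaV
      rcases ha with ha | ⟨rfl, ha⟩
      · nlinarith
      · linarith [(by exact_mod_cast ha : (i : ℤ) < j)]
    have ht₁ : (((1 - C.alphaV k a i).toNat - 1 : ℕ) : ℤ) + 1 = 1 - C.alphaV k a i := by omega
    rw [C.ncdet_eq_zero_of_column_eq _ (fun _ _ _ _ => C.PhiW_commute _ _ _ _)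
      (t₁ := ⟨(C.betaV k 0 j).toNat - 1, by omega⟩)
      (t₂ := ⟨(1 - C.alphaV k a i).toNat - 1, by omega⟩)]
    · exact Submodule.zero_mem _
    · rw [Ne, Fin.mk.injEq]
      omega
    · intro r
      rw [if_pos ht₀, if_neg (by rw [ht₁]; exact hlt.ne), ht₁, neg_sub]

end WCtx

open WCtx in
/-- **Lemma 5.3.**  For `1 ≤ i,j ≤ m`, `a ∈ ℤ`, `r ∈ S` (encoded by `k`), `1 ≤ l ≤ n`,
with `a > 0`, or `a = 0` and `i < j`:  if `β(r,0,j) ∉ I_l` then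
`[Σ_c ψ_i^c(a-r)ψ̄_j^c(r), A_l] = 0`; if `β(r,0,j) ∈ I_l` then this commutator equals
`A_l^{i,j,r}`, and moreover `[A_{l'}, A_l^{i,j,r}] = 0` for `l ≤ l' ≤ n`,
`[Ā_{l''}, A_l^{i,j,r}] = 0` for `l < l'' ≤ n`, and `A_l^{i,j,r}|0⟩ = 0`. -/
theorem statement6 (C : WCtx) (i j : ℕ) (hi : 1 ≤ i) (hi' : i ≤ C.m)
    (hj : 1 ≤ j) (hj' : j ≤ C.m) (a k : ℤ) (l : ℕ) (hl : 1 ≤ l) (hl' : l ≤ C.n)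
    (ha : 0 < a ∨ (a = 0 ∧ i < j)) :
    (¬ (1 ≤ C.betaV k 0 j ∧ C.betaV k 0 j ≤ (l : ℤ)) →
      C.Esum i j a k * C.Adet l - C.Adet l * C.Esum i j a k = 0)
    ∧
    ((1 ≤ C.betaV k 0 j ∧ C.betaV k 0 j ≤ (l : ℤ)) →
      (C.Esum i j a k * C.Adet l - C.Adet l * C.Esum i j a k = C.Amod l i j a k)
      ∧ (∀ l' : ℕ, l ≤ l' → l' ≤ C.n →
          C.Adet l' * C.Amod l i j a k - C.Amod l i j a k * C.Adet l' = 0)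
      ∧ (∀ l'' : ℕ, l < l'' → l'' ≤ C.n →
          C.Abar l'' * C.Amod l i j a k - C.Amod l i j a k * C.Abar l'' = 0)
      ∧ C.Amod l i j a k • C.vac = 0) := by
  refine ⟨fun hb => ?_, fun hb => ⟨?_, fun l' _ _ => ?_, fun l'' hl'' _ => ?_,
    C.Amod_smul_vac hi hi' hj ha hb.1 hb.2⟩⟩
  · refine sub_eq_zero.2 (C.ncdet_commute_right _ _ fun r t => sub_eq_zero.1 ?_)
    rw [C.Esum_mul_PhiW_sub hi hi' hj hj' (by omega), if_neg (by omega)]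
  · have hiff : ∀ t : Fin l, t = ⟨(C.betaV k 0 j).toNat - 1, by omega⟩ ↔
        ((t : ℕ) : ℤ) + 1 = C.betaV k 0 j := fun t => by rw [Fin.ext_iff]; simp only; omega
    unfold Adet
    rw [C.mul_ncdet_sub _ _ (fun r => C.PhiW ((r : ℕ) + 1) (C.alphaV k a i - 1))
      ⟨(C.betaV k 0 j).toNat - 1, by omega⟩]
    · simp only [hiff, Amod]
    · intro r t
      simp only [hiff]
      exact C.Esum_mul_PhiW_sub hi hi' hj hj' (by omega) _ _ _
  · rw [Amod_eq_ncdet_PhiW]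
    exact sub_eq_zero.2 (C.ncdet_commute_ncdet _ _ fun _ _ _ _ => C.PhiW_commute _ _ _ _)
  · rw [Amod_eq_ncdet_PhiW]
    exact sub_eq_zero.2 (C.ncdet_commute_ncdet _ _ fun _ _ _ _ =>
      C.PhibarW_commute_PhiW (by omega) (by omega) (by omega) _ _)
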